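/- The diagonal matrix operator diag(G_+(k_+), G_+(k_-)) satisfies the transmutation property Ĝ_+ D̂_k = D̂_{k+(0,1)} Ĝ_+, where G_+(k) = (z - z^{-1})^{-1} z∂z. -/

import Mathlib

open Polynomial

/-- `f : ℂ → ℂ` is (the evaluation of) a Laurent polynomial. -/
def IsLaurent (f : ℂ → ℂ) : Prop :=
  ∃ (p : Polynomial ℂ) (n : ℕ), ∀ z : ℂ, z ≠ 0 → f z = p.eval z / z ^ n

/-- The contiguity shift operator `E₊(k)`. -/
noncomputable def Eplus (k1 k2 : ℂ) (f : ℂ → ℂ) : ℂ → ℂ := fun z =>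
  ((1 + z⁻¹) / (1 - z⁻¹)) * (z * deriv f z) + (k2 - 1/2) * f z

/-- The contiguity shift operator `E₋(k)`. -/
noncomputable def Eminus (k1 k2 : ℂ) (f : ℂ → ℂ) : ℂ → ℂ := fun z =>
  ((1 - z⁻¹) / (1 + z⁻¹)) * (z * deriv f z) + (k1 + k2 - 1/2) * f z

/-- The forward shift operator `G₊(k) = (z - z⁻¹)⁻¹ z∂z` (independent of `k`). -/
noncomputable def Gplus (f : ℂ → ℂ) : ℂ → ℂ := fun z =>
  (z - z⁻¹)⁻¹ * (z * deriv f z)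

/-- The 2×2 matrix operator `D̂_k = [[(1-k₁)/2, -E₊(k₋)], [-E₋(k₊), (1+k₁)/2]]`. -/
noncomputable def Dhat (k1 k2 : ℂ) (fg : (ℂ → ℂ) × (ℂ → ℂ)) : (ℂ → ℂ) × (ℂ → ℂ) :=
  (fun z => (1 - k1) / 2 * fg.1 z - Eplus (k1 - 1) (k2 + 1) fg.2 z,
   fun z => -Eminus (k1 + 1) k2 fg.1 z + (1 + k1) / 2 * fg.2 z)

/-- `Ĝ₊ = diag(G₊(k₊), G₊(k₋))`. -/
noncomputable def Ghat (fg : (ℂ → ℂ) × (ℂ → ℂ)) : (ℂ → ℂ) × (ℂ → ℂ) :=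
  (Gplus fg.1, Gplus fg.2)

theorem IsLaurent.diffOn {f : ℂ → ℂ} (hf : IsLaurent f) : DifferentiableOn ℂ f {z | z ≠ 0} := by
  obtain ⟨p, n, h⟩ := hf
  have h1 : DifferentiableOn ℂ (fun z : ℂ => p.eval z / z ^ n) {z | z ≠ 0} := by
    intro z (hz : z ≠ 0)
    exact (p.differentiable.differentiableAt.div (differentiableAt_fun_id.pow n)
      (by simpa using pow_ne_zero n hz)).differentiableWithinAt
  exact h1.congr (fun z hz => h z hz)

theorem IsLaurent.derivs {f : ℂ → ℂ} (hf : IsLaurent f) {z : ℂ} (hz : z ≠ 0) :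
    HasDerivAt f (deriv f z) z ∧ HasDerivAt (deriv f) (deriv (deriv f) z) z := by
  have ho : IsOpen {z : ℂ | z ≠ 0} := isOpen_ne
  exact ⟨(hf.diffOn.differentiableAt (ho.mem_nhds hz)).hasDerivAt,
    ((hf.diffOn.deriv ho).differentiableAt (ho.mem_nhds hz)).hasDerivAt⟩

/-- The transmutation property `Ĝ₊ D̂_k = D̂_{k+(0,1)} Ĝ₊`. -/
theorem stmt6 (k1 k2 : ℂ) (f g : ℂ → ℂ) (hf : IsLaurent f) (hg : IsLaurent g)
    (z : ℂ) (hz : z ≠ 0) (hz2 : z ^ 2 ≠ 1) :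
    (Ghat (Dhat k1 k2 (f, g))).1 z = (Dhat k1 (k2 + 1) (Ghat (f, g))).1 z ∧
    (Ghat (Dhat k1 k2 (f, g))).2 z = (Dhat k1 (k2 + 1) (Ghat (f, g))).2 z := by
  have h1 : z - 1 ≠ 0 := fun h => hz2 (by linear_combination (z + 1) * h)
  have h2 : z + 1 ≠ 0 := fun h => hz2 (by linear_combination (z - 1) * h)
  have e1 : 1 - z⁻¹ = (z - 1) / z := by field_simp
  have e2 : 1 + z⁻¹ = (z + 1) / z := by field_simp
  have e3 : z - z⁻¹ = (z - 1) * (z + 1) / z := by field_simp; ring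
  have n1 : 1 - z⁻¹ ≠ 0 := by rw [e1]; exact div_ne_zero h1 hz
  have n2 : 1 + z⁻¹ ≠ 0 := by rw [e2]; exact div_ne_zero h2 hz
  have n3 : z - z⁻¹ ≠ 0 := by rw [e3]; exact div_ne_zero (mul_ne_zero h1 h2) hz
  obtain ⟨f1, f2⟩ := hf.derivs hz
  obtain ⟨g1, g2⟩ := hg.derivs hz
  have hi := hasDerivAt_inv hz
  have hid := hasDerivAt_id' z
  have hG : ∀ u : ℂ → ℂ, HasDerivAt (deriv u) (deriv (deriv u) z) z →
      deriv (Gplus u) z = _ := fun u hu =>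
    HasDerivAt.deriv (((hid.sub hi).inv n3).mul (hid.mul hu))
  have hD1 : deriv (Dhat k1 k2 (f, g)).1 z = _ :=
    HasDerivAt.deriv ((f1.const_mul ((1 - k1) / 2)).sub
      ((((hi.const_add 1).div (hi.const_sub 1) n1).mul (hid.mul g2)).add
        (g1.const_mul (k2 + 1 - 1/2))))
  have hD2 : deriv (Dhat k1 k2 (f, g)).2 z = _ :=
    HasDerivAt.deriv (((((hi.const_sub 1).div (hi.const_add 1) n2).mul (hid.mul f2)).add
        (f1.const_mul (k1 + 1 + k2 - 1/2))).neg.add (g1.const_mul ((1 + k1) / 2)))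
  constructor
  · change (z - z⁻¹)⁻¹ * (z * deriv (Dhat k1 k2 (f, g)).1 z) =
      (1 - k1) / 2 * ((z - z⁻¹)⁻¹ * (z * deriv f z)) -
      (((1 + z⁻¹) / (1 - z⁻¹)) * (z * deriv (Gplus g) z) +
        (k2 + 1 + 1 - 1/2) * ((z - z⁻¹)⁻¹ * (z * deriv g z)))
    rw [hD1, hG g g2]
    simp only [Pi.mul_apply, Pi.inv_apply, Pi.sub_apply, Pi.div_apply, e1, e2, e3]
    field_simp
    ring
  · change (z - z⁻¹)⁻¹ * (z * deriv (Dhat k1 k2 (f, g)).2 z) =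
      -(((1 - z⁻¹) / (1 + z⁻¹)) * (z * deriv (Gplus f) z) +
        (k1 + 1 + (k2 + 1) - 1/2) * ((z - z⁻¹)⁻¹ * (z * deriv f z))) +
      (1 + k1) / 2 * ((z - z⁻¹)⁻¹ * (z * deriv g z))
    rw [hD2, hG f f2]
    simp only [Pi.mul_apply, Pi.inv_apply, Pi.sub_apply, Pi.div_apply, e1, e2, e3]
    field_simp
    ring
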